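/- Let l ≥ 2 be an integer and let A be the 4×4 real matrix with rows (0, 0, 0, 0), (0, 2l, l(l−1), l(2l−1)), (1, 0, 0, 2), (0, 0, 1, 0). Then for every n ≥ 1, the sum of the entries of the first column of A^n equals (1/4)·(2l)^n + ((l(√2 − 2) − 2√2 + 2)/8)·(−√2)^n + ((l(−2 − √2) + 2 + 2√2)/8)·(√2)^n. -/

import Mathlib

open Finset

/-- Closed form of the first column of a positive power of the action matrix, in terms of a
square root `s` of `2`. -/
theorem actionMatrix_pow_succ_col_zero (x s : ℝ) (hs : s ^ 2 = 2) (n : ℕ) :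
    ((!![(0 : ℝ), 0, 0, 0;
        0, 2 * x, x * (x - 1), x * (2 * x - 1);
        1, 0, 0, 2;
        0, 0, 1, 0] : Matrix (Fin 4) (Fin 4) ℝ) ^ (n + 1)).col 0 =
      ![0,
        (1 / 4) * (2 * x) ^ (n + 1) + ((x * (s - 2)) / 8) * (-s) ^ (n + 1) +
          ((x * (-2 - s)) / 8) * s ^ (n + 1),
        (s / 4) * (s ^ (n + 1) - (-s) ^ (n + 1)),
        (1 / 4) * (s ^ (n + 1) + (-s) ^ (n + 1))] := by
  induction n with
  | zero =>
    ext i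
    fin_cases i <;> simp [Matrix.col] <;> grind
  | succ n ih =>
    have h (i : Fin 4) := congrFun ih i
    ext i
    rw [Matrix.col_apply, pow_succ', Matrix.mul_apply, Fin.sum_univ_four]
    simp only [Matrix.col_apply] at h
    rw [h 0, h 1, h 2, h 3]
    generalize hp : s ^ (n + 1) = p
    generalize hq : (-s) ^ (n + 1) = q
    generalize hr : (2 * x) ^ (n + 1) = r
    fin_cases i <;> simp [pow_succ _ (n + 1), hp, hq, hr] <;> grind

theorem stmt_19 (l : ℕ) (hl : 2 ≤ l) (n : ℕ) (hn : 1 ≤ n) :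
    ∑ i : Fin 4,
      ((!![(0 : ℝ), 0, 0, 0;
           0, 2 * (l : ℝ), (l : ℝ) * ((l : ℝ) - 1), (l : ℝ) * (2 * (l : ℝ) - 1);
           1, 0, 0, 2;
           0, 0, 1, 0] : Matrix (Fin 4) (Fin 4) ℝ) ^ n) i 0 =
    (1 / 4) * (2 * (l : ℝ)) ^ n +
      (((l : ℝ) * (Real.sqrt 2 - 2) - 2 * Real.sqrt 2 + 2) / 8) * (-Real.sqrt 2) ^ n +
      (((l : ℝ) * (-2 - Real.sqrt 2) + 2 + 2 * Real.sqrt 2) / 8) * (Real.sqrt 2) ^ n := by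
  obtain ⟨m, rfl⟩ : ∃ m, n = m + 1 := ⟨n - 1, by lia⟩
  have h (i : Fin 4) := congrFun
    (actionMatrix_pow_succ_col_zero l (Real.sqrt 2) (Real.sq_sqrt (by norm_num)) m) i
  simp only [Matrix.col_apply] at h
  rw [Fin.sum_univ_four, h 0, h 1, h 2, h 3]
  simp only [Matrix.cons_val]
  ring
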